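/- arXiv:1505.00870 — 2 statements merged into one kernel-verified Lean document; each statement's English description precedes it below -/
import Mathlib

section
/- Let z, w ∈ T with w ≠ 0. If ⟨z, w⟩ ≤ ε, then P_{B(w,ε)}(z) = z. Otherwise (i.e., if ⟨z, w⟩ > ε), the projection satisfies ⟨P_{B(w,ε)}(z), w⟩ = ε. -/
open Finset

/-- The monotone nonnegative cone `T = {x : x₁ ≥ x₂ ≥ ⋯ ≥ xₙ ≥ 0}`. -/
def coneT (n : ℕ) : Set (Fin n → ℝ) := {x | Antitone x ∧ ∀ i, 0 ≤ x i}

/-- Euclidean inner product on `Fin n → ℝ`. -/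
def dot {n : ℕ} (x y : Fin n → ℝ) : ℝ := ∑ i, x i * y i

/-- `x` is the Euclidean projection of `z` onto `C` (minimizer of the distance to `z` over `C`). -/
def IsProjOn {n : ℕ} (C : Set (Fin n → ℝ)) (z x : Fin n → ℝ) : Prop :=
  x ∈ C ∧ ∀ y ∈ C, ∑ i, (x i - z i) ^ 2 ≤ ∑ i, (y i - z i) ^ 2

/-- The ordered weighted ℓ₁ (OWL) norm `Ω_w(x) = ∑ᵢ wᵢ |x|_[i]`,
where `|x|_[i]` is the i-th largest entry of `(|x₁|, …, |xₙ|)`. -/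
noncomputable def owl {n : ℕ} (w x : Fin n → ℝ) : ℝ :=
  ∑ i : Fin n, w i * |x ((Tuple.sort fun j => |x j|) i.rev)|

/-- The closed OWL norm ball `B(w, ε)`. -/
def owlBall {n : ℕ} (w : Fin n → ℝ) (ε : ℝ) : Set (Fin n → ℝ) := {x | owl w x ≤ ε}

/-- The half-space `L(w, ε) = {x : ⟨w, x⟩ ≤ ε}`. -/
def halfSpace {n : ℕ} (w : Fin n → ℝ) (ε : ℝ) : Set (Fin n → ℝ) := {x | dot w x ≤ ε}

/-- The hyperplane `H(w, ε) = {x : ⟨w, x⟩ = ε}`. -/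
def hyperplane {n : ℕ} (w : Fin n → ℝ) (ε : ℝ) : Set (Fin n → ℝ) := {x | dot w x = ε}

/-- `P ∈ 𝒫ₙ`: a partition of `{0, …, n-1}` all of whose blocks are intervals. -/
def IsIntervalPartition {n : ℕ} (P : Finset (Finset (Fin n))) : Prop :=
  (∀ G ∈ P, G.Nonempty) ∧
  (∀ i : Fin n, ∃! G, G ∈ P ∧ i ∈ G) ∧
  (∀ G ∈ P, ∀ i ∈ G, ∀ k ∈ G, ∀ j : Fin n, i ≤ j → j ≤ k → j ∈ G)

/-- `P ≼ Q`: every block of `P` is contained in some block of `Q`. -/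
def Refines {n : ℕ} (P Q : Finset (Finset (Fin n))) : Prop :=
  ∀ G ∈ P, ∃ H ∈ Q, G ⊆ H

/-- `i` and `j` lie in a common block of `P`. -/
def SameBlock {n : ℕ} (P : Finset (Finset (Fin n))) (i j : Fin n) : Prop :=
  ∃ G ∈ P, i ∈ G ∧ j ∈ G

/-- `P = 𝒢(z)`: the partition of indices into maximal intervals of nondecreasing
components of `z`; consecutive indices lie in the same block iff `zᵢ ≤ zᵢ₊₁`. -/
def IsGroupPartition {n : ℕ} (z : Fin n → ℝ) (P : Finset (Finset (Fin n))) : Prop :=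
  IsIntervalPartition P ∧
  ∀ (i : Fin n) (h : i.val + 1 < n),
    (SameBlock P i ⟨i.val + 1, h⟩ ↔ z i ≤ z ⟨i.val + 1, h⟩)

/-- `v = z_P`: the vector obtained from `z` by averaging over the blocks of `P`. -/
def IsAvg {n : ℕ} (P : Finset (Finset (Fin n))) (z v : Fin n → ℝ) : Prop :=
  ∀ G ∈ P, ∀ i ∈ G, v i = (∑ k ∈ G, z k) / (G.card : ℝ)

/-- `(lam, v)` is a KKT pair for `x` in the reduced problem
`min ½‖x − z‖² s.t. ⟨w, x⟩ = ε, x ∈ T`. -/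
def IsKKT {n : ℕ} (z w : Fin n → ℝ) (ε : ℝ) (x : Fin n → ℝ) (lam : ℝ)
    (v : Fin n → ℝ) : Prop :=
  0 < lam ∧ (∀ i, 0 ≤ v i) ∧ x ∈ coneT n ∧
  (∀ (i : Fin n) (h : i.val + 1 < n), v i * (x i - x ⟨i.val + 1, h⟩) = 0) ∧
  (∀ h : 0 < n, v ⟨n - 1, Nat.sub_lt h one_pos⟩ * x ⟨n - 1, Nat.sub_lt h one_pos⟩ = 0) ∧
  (∀ i : Fin n, x i = z i - lam * w i + v i -
    (if _ : i.val = 0 then 0 else v ⟨i.val - 1, lt_of_le_of_lt (Nat.sub_le _ _) i.isLt⟩)) ∧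
  dot w x = ε

/-- The last index `n - 1` of `Fin n`. -/
def lastIdx {n : ℕ} (hn : 0 < n) : Fin n := ⟨n - 1, Nat.sub_lt hn one_pos⟩

/-- `r = min {(zᵢ − zᵢ₊₁)/(wᵢ − wᵢ₊₁)}` in the extended reals, with `0/0 = ∞`, `a/0 = ∞`. -/
noncomputable def rmin {n : ℕ} (z w : Fin n → ℝ) : EReal :=
  ⨅ i : Fin n,
    if h : i.val + 1 < n then
      (if w i - w ⟨i.val + 1, h⟩ = 0 then (⊤ : EReal)
       else (((z i - z ⟨i.val + 1, h⟩) / (w i - w ⟨i.val + 1, h⟩) : ℝ) : EReal))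
    else ⊤

/-- `λ₁ = (⟨z, w⟩ − ε)/‖w‖²`. -/
noncomputable def lam1 {n : ℕ} (z w : Fin n → ℝ) (ε : ℝ) : ℝ :=
  (dot z w - ε) / dot w w

/-- `λ₀ = ((Σ_{i : zᵢ > zₙ} zᵢwᵢ) − ε)/(Σ_{i : zᵢ > zₙ} wᵢ²)`. -/
noncomputable def lam0 {n : ℕ} (hn : 0 < n) (z w : Fin n → ℝ) (ε : ℝ) : ℝ :=
  ((∑ i ∈ Finset.univ.filter (fun i => z (lastIdx hn) < z i), z i * w i) - ε) /
    (∑ i ∈ Finset.univ.filter (fun i => z (lastIdx hn) < z i), w i ^ 2)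

/-- `n' = min({k : z_k − λ₀ w_k < 0} ∪ {n+1})`, with 1-based indexing `k = i + 1`. -/
noncomputable def nprime {n : ℕ} (z w : Fin n → ℝ) (l0 : ℝ) : ℕ :=
  sInf {k | k = n + 1 ∨ ∃ i : Fin n, i.val + 1 = k ∧ z i - l0 * w i < 0}

/-- Componentwise sign, with the convention `sgn 0 = 1`. -/
noncomputable def sgn (t : ℝ) : ℝ := if t < 0 then -1 else 1

/-- The simplex `Δ(κ, n) = {x : x ≥ 0, Σ xᵢ = κ}`. -/
def simplexSet (κ : ℝ) (n : ℕ) : Set (Fin n → ℝ) :=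
  {x | (∀ i, 0 ≤ x i) ∧ ∑ i, x i = κ}


/-- The decreasing rearrangement of `|x|`. -/
noncomputable def decrRearr {n : ℕ} (x : Fin n → ℝ) (i : Fin n) : ℝ :=
  |x ((Tuple.sort fun j => |x j|) i.rev)|

theorem decrRearr_mem_coneT {n : ℕ} (x : Fin n → ℝ) : decrRearr x ∈ coneT n :=
  ⟨fun _ _ h => Tuple.monotone_sort (fun j => |x j|) (Fin.rev_le_rev.2 h), fun _ => abs_nonneg _⟩

theorem sum_comp_decrRearr {n : ℕ} (x : Fin n → ℝ) (f : ℝ → ℝ) :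
    ∑ i, f (decrRearr x i) = ∑ i, f |x i| :=
  Equiv.sum_comp (Fin.revPerm.trans (Tuple.sort fun j => |x j|)) fun i => f |x i|

theorem owl_eq_dot_decrRearr {n : ℕ} (w x : Fin n → ℝ) : owl w x = dot w (decrRearr x) := rfl

theorem dot_comm {n : ℕ} (x y : Fin n → ℝ) : dot x y = dot y x := by
  simp only [dot, mul_comm]

theorem sum_mul_abs_comp_perm_le_owl {n : ℕ} {w : Fin n → ℝ} (hw : Antitone w)
    (x : Fin n → ℝ) (π : Equiv.Perm (Fin n)) : ∑ i, w i * |x (π i)| ≤ owl w x := by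
  have h := (hw.monovary (decrRearr_mem_coneT x).1).sum_mul_comp_perm_le_sum_mul
    (σ := π.trans ((Tuple.sort fun j => |x j|).symm.trans Fin.revPerm))
  simpa [decrRearr, owl] using h

theorem dot_le_owl {n : ℕ} {w : Fin n → ℝ} (hw : w ∈ coneT n) (x : Fin n → ℝ) :
    dot w x ≤ owl w x :=
  (sum_le_sum fun i _ => mul_le_mul_of_nonneg_left (le_abs_self (x i)) (hw.2 i)).trans
    (sum_mul_abs_comp_perm_le_owl hw.1 x (Equiv.refl _))

theorem owl_eq_dot_of_mem_coneT {n : ℕ} {w x : Fin n → ℝ} (hw : w ∈ coneT n)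
    (hx : x ∈ coneT n) : owl w x = dot w x := by
  refine le_antisymm ?_ (dot_le_owl hw x)
  have h := (hw.1.monovary hx.1).sum_mul_comp_perm_le_sum_mul
    (σ := Fin.revPerm.trans (Tuple.sort fun j => |x j|))
  simpa [owl, dot, abs_of_nonneg (hx.2 _)] using h

theorem owl_midpoint_le {n : ℕ} {w : Fin n → ℝ} (hw : w ∈ coneT n) (x y : Fin n → ℝ) :
    owl w (fun i => (x i + y i) / 2) ≤ (owl w x + owl w y) / 2 := by
  let π : Equiv.Perm (Fin n) :=
    Fin.revPerm.trans (Tuple.sort fun j => |(x j + y j) / 2|)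
  calc owl w (fun i => (x i + y i) / 2)
      = ∑ i, w i * |(x (π i) + y (π i)) / 2| := rfl
    _ ≤ ∑ i, (w i * |x (π i)| + w i * |y (π i)|) / 2 := by
        refine sum_le_sum fun i _ => ?_
        rw [abs_div, abs_two]
        nlinarith [mul_le_mul_of_nonneg_left (abs_add_le (x (π i)) (y (π i))) (hw.2 i)]
    _ = (∑ i, w i * |x (π i)| + ∑ i, w i * |y (π i)|) / 2 := by
        rw [← sum_div, sum_add_distrib]
    _ ≤ (owl w x + owl w y) / 2 := by
        linarith [sum_mul_abs_comp_perm_le_owl hw.1 x π, sum_mul_abs_comp_perm_le_owl hw.1 y π]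

theorem sum_decrRearr_sub_sq_le {n : ℕ} {z : Fin n → ℝ} (hz : z ∈ coneT n) (x : Fin n → ℝ) :
    ∑ i, (decrRearr x i - z i) ^ 2 ≤ ∑ i, (x i - z i) ^ 2 := by
  have expand (u : Fin n → ℝ) :
      ∑ i, (u i - z i) ^ 2 = ∑ i, u i ^ 2 - 2 * dot z u + ∑ i, z i ^ 2 := by
    rw [dot, mul_sum, ← sum_sub_distrib, ← sum_add_distrib]
    exact sum_congr rfl fun i _ => by ring
  have hsq := sum_comp_decrRearr x (· ^ 2)
  simp only [sq_abs] at hsq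
  have hdot := dot_le_owl hz x
  rw [owl_eq_dot_decrRearr] at hdot
  rw [expand, expand]
  linarith

theorem IsProjOn.mem_coneT {n : ℕ} {w z x : Fin n → ℝ} {ε : ℝ} (hw : w ∈ coneT n)
    (hz : z ∈ coneT n) (hx : IsProjOn (owlBall w ε) z x) : x ∈ coneT n := by
  obtain ⟨hxB : owl w x ≤ ε, hmin⟩ := hx
  have hy : owl w (decrRearr x) = owl w x :=
    owl_eq_dot_of_mem_coneT hw (decrRearr_mem_coneT x)
  have hm := hmin (fun i => (x i + decrRearr x i) / 2)
    ((owl_midpoint_le hw x (decrRearr x)).trans (by linarith))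
  have hpar : ∑ i, ((x i + decrRearr x i) / 2 - z i) ^ 2 =
      (∑ i, (x i - z i) ^ 2 + ∑ i, (decrRearr x i - z i) ^ 2) / 2
        - (∑ i, (x i - decrRearr x i) ^ 2) / 4 := by
    rw [← sum_add_distrib, sum_div, sum_div, ← sum_sub_distrib]
    exact sum_congr rfl fun i _ => by ring
  have hzero : ∑ i, (x i - decrRearr x i) ^ 2 = 0 :=
    le_antisymm (by linarith [sum_decrRearr_sub_sq_le hz x]) (sum_nonneg fun i _ => sq_nonneg _)
  have heq : x = decrRearr x := funext fun i => sub_eq_zero.1 <| pow_eq_zero_iff two_ne_zero |>.1 <|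
    (sum_eq_zero_iff_of_nonneg fun i _ => sq_nonneg _).1 hzero i (mem_univ i)
  rw [heq]
  exact decrRearr_mem_coneT x

theorem convex_combination_mem_coneT {n : ℕ} {x z : Fin n → ℝ} (hx : x ∈ coneT n)
    (hz : z ∈ coneT n) {t : ℝ} (ht0 : 0 ≤ t) (ht1 : t ≤ 1) :
    (fun i => (1 - t) * x i + t * z i) ∈ coneT n := by
  have h1 : 0 ≤ 1 - t := sub_nonneg.2 ht1
  exact ⟨fun i j h => add_le_add (mul_le_mul_of_nonneg_left (hx.1 h) h1)
      (mul_le_mul_of_nonneg_left (hz.1 h) ht0),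
    fun i => add_nonneg (mul_nonneg h1 (hx.2 i)) (mul_nonneg ht0 (hz.2 i))⟩

/-- Let `z, w ∈ T`, `w ≠ 0`. If `⟨z,w⟩ ≤ ε` then `P_{B(w,ε)}(z) = z`;
otherwise `⟨P_{B(w,ε)}(z), w⟩ = ε`. -/
theorem proj_owlBall_cases {n : ℕ} (hn : 1 ≤ n) (ε : ℝ) (hε : 0 < ε)
    (w : Fin n → ℝ) (hw_anti : Antitone w) (hw_nonneg : ∀ i, 0 ≤ w i) (hw_ne : w ≠ 0)
    (z : Fin n → ℝ) (hz : z ∈ coneT n) (hw : w ∈ coneT n) :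
    (dot z w ≤ ε → IsProjOn (owlBall w ε) z z) ∧
    (ε < dot z w → ∀ x, IsProjOn (owlBall w ε) z x → dot x w = ε) := by
  refine ⟨fun h => ⟨?_, fun y _ => ?_⟩, fun h x hx => ?_⟩
  · change owl w z ≤ ε
    rwa [owl_eq_dot_of_mem_coneT hw hz, dot_comm]
  · simpa using sum_nonneg fun i (_ : i ∈ univ) => sq_nonneg (y i - z i)
  have hxT := hx.mem_coneT hw hz
  obtain ⟨hxB : owl w x ≤ ε, hmin⟩ := hx
  rw [owl_eq_dot_of_mem_coneT hw hxT] at hxB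
  rw [dot_comm] at h ⊢
  refine hxB.antisymm (not_lt.1 fun hlt => ?_)
  have hd : 0 < dot w z - dot w x := by linarith
  set t := (ε - dot w x) / (dot w z - dot w x)
  have ht0 : 0 < t := div_pos (by linarith) hd
  have ht1 : t ≤ 1 := (div_le_one hd).2 (by linarith)
  have htd : t * (dot w z - dot w x) = ε - dot w x := div_mul_cancel₀ _ hd.ne'
  have hcomb : dot w (fun i => (1 - t) * x i + t * z i) = (1 - t) * dot w x + t * dot w z := by
    simp only [dot, mul_sum, ← sum_add_distrib]
    exact sum_congr rfl fun i _ => by ring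
  have hle := hmin (fun i => (1 - t) * x i + t * z i) <| by
    change owl w _ ≤ ε
    rw [owl_eq_dot_of_mem_coneT hw (convex_combination_mem_coneT hxT hz ht0.le ht1), hcomb]
    linarith
  have hdist : ∑ i, ((1 - t) * x i + t * z i - z i) ^ 2 =
      (1 - t) ^ 2 * ∑ i, (x i - z i) ^ 2 := by
    rw [mul_sum]
    exact sum_congr rfl fun i _ => by ring
  have hpos : 0 < ∑ i, (x i - z i) ^ 2 := by
    refine (sum_nonneg fun i _ => sq_nonneg _).lt_of_ne' fun h0 => ?_
    have hxz : x = z := funext fun i => sub_eq_zero.1 <| pow_eq_zero_iff two_ne_zero |>.1 <|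
      (sum_eq_zero_iff_of_nonneg fun i _ => sq_nonneg _).1 h0 i (mem_univ i)
    rw [hxz] at hd
    linarith
  rw [hdist] at hle
  nlinarith [mul_pos ht0 hpos, mul_nonneg (mul_pos ht0 hpos).le (sub_nonneg.2 ht1)]
end

section
/- Assume z, w ∈ T, w ≠ 0, ⟨w, z⟩ > ε, and w = w_{𝒢(z)}. Let x* = P_{H(w,ε) ∩ T}(z) and 𝒢* = 𝒢(x*). If λ₁ ≤ r < ∞, zₙ − λ₁wₙ < 0, λ₀ ≤ r, and n' < n with z_{n'} ≠ zₙ, then the family 𝒢₀ = {G ∈ 𝒢(z) : max(G) < n'} ∪ {{n', …, n}} satisfies: 𝒢₀ ∈ 𝒫ₙ, 𝒢(z) ≼ 𝒢₀ = 𝒢(z_{𝒢₀}) ≼ 𝒢*, and |𝒢(z_{𝒢₀})| ≤ |𝒢(z)| − 1. -/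
open Finset

open Matrix in
theorem dot_eq_dotProduct {n : ℕ} (x y : Fin n → ℝ) : dot x y = x ⬝ᵥ y := rfl

theorem convex_coneT (n : ℕ) : Convex ℝ (coneT n) := by
  intro x hx y hy a b ha hb _
  refine ⟨fun i j hij => ?_, fun i => ?_⟩
  · have h₁ := mul_le_mul_of_nonneg_left (hx.1 hij) ha
    have h₂ := mul_le_mul_of_nonneg_left (hy.1 hij) hb
    simpa using add_le_add h₁ h₂
  · simpa using add_nonneg (mul_nonneg ha (hx.2 i)) (mul_nonneg hb (hy.2 i))

theorem convex_setOf_dot_eq {n : ℕ} (w : Fin n → ℝ) (ε : ℝ) : Convex ℝ (hyperplane w ε) := by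
  intro x hx y hy a b _ _ hab
  simp only [hyperplane, Set.mem_ofPred_eq, dot_eq_dotProduct] at hx hy ⊢
  rw [dotProduct_add, dotProduct_smul, dotProduct_smul, hx, hy, ← add_smul, hab, one_smul]

theorem smul_mem_coneT {n : ℕ} {x : Fin n → ℝ} (hx : x ∈ coneT n) {c : ℝ} (hc : 0 ≤ c) :
    c • x ∈ coneT n :=
  ⟨fun i j hij => by simpa using mul_le_mul_of_nonneg_left (hx.1 hij) hc,
    fun i => by simpa using mul_nonneg hc (hx.2 i)⟩

/-- The variational inequality characterizing projections onto convex sets. -/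
theorem IsProjOn.dot_sub_nonpos {n : ℕ} {C : Set (Fin n → ℝ)} (hC : Convex ℝ C)
    {z x y : Fin n → ℝ} (h : IsProjOn C z x) (hy : y ∈ C) : dot (z - x) (y - x) ≤ 0 := by
  by_contra! hA
  set A := dot (z - x) (y - x) with hAdef
  set B := dot (y - x) (y - x) with hBdef
  have hB : 0 ≤ B := Finset.sum_nonneg fun i _ => mul_self_nonneg _
  have key : ∀ t : ℝ, 0 ≤ t → t ≤ 1 → 2 * t * A ≤ t ^ 2 * B := by
    intro t ht₀ ht₁
    have hmem := hC.add_smul_sub_mem h.1 hy ⟨ht₀, ht₁⟩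
    have hle := h.2 _ hmem
    have hexp : ∑ i, ((x + t • (y - x)) i - z i) ^ 2 =
        ∑ i, (x i - z i) ^ 2 - 2 * t * A + t ^ 2 * B := by
      rw [hAdef, hBdef, dot, dot, Finset.mul_sum, Finset.mul_sum, ← Finset.sum_sub_distrib,
        ← Finset.sum_add_distrib]
      refine Finset.sum_congr rfl fun i _ => ?_
      simp only [Pi.add_apply, Pi.smul_apply, Pi.sub_apply, smul_eq_mul]
      ring
    linarith
  have hAB : 0 < A + B := by linarith
  have ht : 0 < A / (A + B) := div_pos hA hAB
  have h₁ := key (A / (A + B)) ht.le ((div_le_one hAB).2 (by linarith))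
  have h₂ : A / (A + B) * B ≤ A := by
    rw [div_mul_eq_mul_div, div_le_iff₀ hAB]
    nlinarith
  nlinarith [mul_pos ht hA]

theorem dot_pos_of_mem_coneT {n : ℕ} {x w : Fin n → ℝ} (hx : x ∈ coneT n) (hw : w ∈ coneT n)
    (hx₀ : x ≠ 0) (hw₀ : w ≠ 0) : 0 < dot w x := by
  obtain ⟨i, hi⟩ := Function.ne_iff.1 hx₀
  obtain ⟨j, hj⟩ := Function.ne_iff.1 hw₀
  have hxi : 0 < x (min i j) := ((hx.2 i).lt_of_ne' hi).trans_le (hx.1 (min_le_left i j))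
  have hwj : 0 < w (min i j) := ((hw.2 j).lt_of_ne' hj).trans_le (hw.1 (min_le_right i j))
  exact Finset.sum_pos' (fun k _ => mul_nonneg (hw.2 k) (hx.2 k))
    ⟨_, Finset.mem_univ _, mul_pos hwj hxi⟩

/-- `x` is the projection of `u` onto the cone `T`, expressed by Moreau's conditions. -/
def IsConeProj {n : ℕ} (u x : Fin n → ℝ) : Prop :=
  x ∈ coneT n ∧ dot (u - x) x = 0 ∧ ∀ y ∈ coneT n, dot (u - x) y ≤ 0

/-- Lagrange multiplier for the constraint `⟨w, x⟩ = ε`. -/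
theorem IsProjOn.exists_isConeProj {n : ℕ} {w z x : Fin n → ℝ} {ε : ℝ} (hε : 0 < ε)
    (hw : w ∈ coneT n) (hw₀ : w ≠ 0) (h : IsProjOn (hyperplane w ε ∩ coneT n) z x) :
    ∃ l : ℝ, IsConeProj (z - l • w) x := by
  have hwx : dot w x = ε := h.1.1
  refine ⟨dot (z - x) x / ε, h.1.2, ?_, fun y hy => ?_⟩
  · rw [sub_right_comm]
    simp only [dot_eq_dotProduct] at hwx ⊢
    rw [sub_dotProduct, smul_dotProduct, hwx, smul_eq_mul, div_mul_cancel₀ _ hε.ne', sub_self]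
  · rcases eq_or_ne y 0 with rfl | hy₀
    · simp [dot]
    have hwy := dot_pos_of_mem_coneT hy hw hy₀ hw₀
    have hc : 0 < ε / dot w y := div_pos hε hwy
    have hmem : (ε / dot w y) • y ∈ hyperplane w ε ∩ coneT n := by
      refine ⟨?_, smul_mem_coneT hy hc.le⟩
      simp only [hyperplane, Set.mem_ofPred_eq, dot_eq_dotProduct] at hwy ⊢
      rw [dotProduct_smul, smul_eq_mul, div_mul_cancel₀ _ hwy.ne']
    have hv := h.dot_sub_nonpos ((convex_setOf_dot_eq w ε).inter (convex_coneT n)) hmem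
    rw [sub_right_comm]
    simp only [dot_eq_dotProduct] at hv hwy ⊢
    rw [dotProduct_sub, dotProduct_smul, smul_eq_mul, sub_nonpos, div_mul_eq_mul_div,
      div_le_iff₀ hwy] at hv
    rw [sub_dotProduct, smul_dotProduct, smul_eq_mul, sub_nonpos, div_mul_eq_mul_div,
      le_div_iff₀ hε]
    linarith

theorem IsConeProj.dot_sub_nonpos {n : ℕ} {u x y : Fin n → ℝ} (h : IsConeProj u x)
    (hy : y ∈ coneT n) : dot (u - x) (y - x) ≤ 0 := by
  have h₁ := h.2.1
  have h₂ := h.2.2 y hy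
  simp only [dot_eq_dotProduct] at h₁ h₂ ⊢
  rw [dotProduct_sub, h₁]
  linarith

theorem isConeProj_posPart {n : ℕ} {u : Fin n → ℝ} (hu : Antitone u) :
    IsConeProj u fun i => max (u i) 0 := by
  refine ⟨⟨fun i j hij => max_le_max_right 0 (hu hij), fun i => le_max_right _ _⟩, ?_, ?_⟩
  · refine Finset.sum_eq_zero fun i _ => ?_
    rcases le_total (u i) 0 with h | h <;> simp [h]
  · exact fun y hy => Finset.sum_nonpos fun i _ =>
      mul_nonpos_of_nonpos_of_nonneg (sub_nonpos.2 (le_max_left _ _)) (hy.2 i)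

/-- Projections onto the cone are firmly nonexpansive. -/
theorem IsConeProj.dot_self_sub_le {n : ℕ} {u v x y : Fin n → ℝ} (hx : IsConeProj u x)
    (hy : IsConeProj v y) : dot (x - y) (x - y) ≤ dot (u - v) (x - y) := by
  have h₁ := hx.dot_sub_nonpos hy.1
  have h₂ := hy.dot_sub_nonpos hx.1
  simp only [dot_eq_dotProduct, sub_dotProduct, dotProduct_sub] at h₁ h₂ ⊢
  linarith

theorem lt_of_isConeProj {n : ℕ} {z w x y : Fin n → ℝ} {l l' : ℝ}
    (hx : IsConeProj (z - l • w) x) (hy : IsConeProj (z - l' • w) y) (h : dot w x < dot w y) :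
    l' < l := by
  by_contra! hl
  have h₁ := hx.dot_self_sub_le hy
  have h₂ : dot ((z - l • w) - (z - l' • w)) (x - y) = (l' - l) * (dot w x - dot w y) := by
    simp only [dot_eq_dotProduct]
    rw [sub_sub_sub_cancel_left, ← sub_smul, smul_dotProduct, dotProduct_sub, smul_eq_mul]
  have h₃ : dot (x - y) (x - y) = 0 :=
    le_antisymm (by nlinarith) (Finset.sum_nonneg fun i _ => mul_self_nonneg _)
  rw [dot_eq_dotProduct, dotProduct_self_eq_zero, sub_eq_zero] at h₃
  exact h.ne (by rw [h₃])

theorem IsConeProj.eq_zero_of_neg {n : ℕ} {u x : Fin n → ℝ} (h : IsConeProj u x) {m : Fin n}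
    (hu : ∀ k, m ≤ k → u k < 0) {k : Fin n} (hk : m ≤ k) : x k = 0 := by
  have hmem : (fun i => if m ≤ i then 0 else x i) ∈ coneT n := by
    refine ⟨fun i j hij => ?_, fun i => ?_⟩
    · dsimp only
      split_ifs with h₁ h₂ h₂
      exacts [le_rfl, h.1.2 i, absurd (h₂.trans hij) h₁, h.1.1 hij]
    · dsimp only
      split_ifs
      exacts [le_rfl, h.1.2 i]
  have hv := h.dot_sub_nonpos hmem
  by_contra hxk
  refine hv.not_gt (Finset.sum_pos' (fun i _ => ?_) ⟨k, Finset.mem_univ _, ?_⟩)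
  · by_cases hi : m ≤ i
    · have h₁ := hu i hi
      have h₂ := h.1.2 i
      simp only [Pi.sub_apply, hi, if_true]
      nlinarith
    · simp [hi]
  · have h₁ := hu k hk
    have h₂ := (h.1.2 k).lt_of_ne' hxk
    simp only [Pi.sub_apply, hk, if_true]
    nlinarith

theorem IsConeProj.le_of_le {n : ℕ} {u x : Fin n → ℝ} (h : IsConeProj u x) (i : Fin n)
    (hi : i.val + 1 < n) (hu : u i ≤ u ⟨i.val + 1, hi⟩) : x i ≤ x ⟨i.val + 1, hi⟩ := by
  set j : Fin n := ⟨i.val + 1, hi⟩ with hj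
  by_contra! hlt
  have dot_update : ∀ (k : Fin n) (c : ℝ),
      dot (u - x) (Function.update x k c - x) = (u k - x k) * (c - x k) := by
    intro k c
    rw [dot, Finset.sum_eq_single k]
    · simp
    · intro b _ hb
      simp [hb]
    · simp
  have hi_mem : Function.update x i (x j) ∈ coneT n := by
    refine ⟨fun a b hab => ?_, fun a => ?_⟩
    · simp only [Function.update_apply]
      split_ifs with h₁ h₂ h₂
      · exact le_rfl
      · subst h₁
        exact h.1.1 (show a ≤ j by simp only [hj, Fin.le_def] at *; omega)
      · subst h₂
        exact h.1.1 (show j ≤ b by simp only [hj, Fin.le_def, Fin.ext_iff] at *; omega)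
      · exact h.1.1 hab
    · simp only [Function.update_apply]
      split_ifs <;> exact h.1.2 _
  have hj_mem : Function.update x j (x i) ∈ coneT n := by
    refine ⟨fun a b hab => ?_, fun a => ?_⟩
    · simp only [Function.update_apply]
      split_ifs with h₁ h₂ h₂
      · exact le_rfl
      · subst h₁
        exact h.1.1 (show a ≤ i by simp only [hj, Fin.le_def, Fin.ext_iff] at *; omega)
      · subst h₂
        exact h.1.1 (show i ≤ b by simp only [hj, Fin.le_def] at *; omega)
      · exact h.1.1 hab
    · simp only [Function.update_apply]
      split_ifs <;> exact h.1.2 _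
  have h₁ := h.dot_sub_nonpos hi_mem
  have h₂ := h.dot_sub_nonpos hj_mem
  rw [dot_update] at h₁ h₂
  nlinarith

theorem IsConeProj.eq_of_const {n : ℕ} {u x : Fin n → ℝ} (h : IsConeProj u x) {i j : Fin n}
    (hij : i ≤ j) (hu : ∀ k, i ≤ k → k ≤ j → u k = u i) : x i = x j := by
  refine le_antisymm ?_ (h.1.1 hij)
  obtain ⟨a, ha⟩ := i
  obtain ⟨b, hb⟩ := j
  replace hij : a ≤ b := hij
  induction b, hij using Nat.le_induction with
  | base => exact le_rfl
  | succ b hab ih =>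
    have hle : (⟨b, by omega⟩ : Fin n) ≤ ⟨b + 1, hb⟩ := Nat.le_succ b
    refine (ih _ fun k hk hkb => hu k hk (hkb.trans hle)).trans (h.le_of_le ⟨b, by omega⟩ hb ?_)
    rw [hu _ hab hle, hu _ (Nat.le_succ_of_le hab) le_rfl]

theorem SameBlock.symm {n : ℕ} {P : Finset (Finset (Fin n))} {i j : Fin n}
    (h : SameBlock P i j) : SameBlock P j i :=
  let ⟨G, hG, hi, hj⟩ := h
  ⟨G, hG, hj, hi⟩

theorem sameBlock_comm {n : ℕ} {P : Finset (Finset (Fin n))} {i j : Fin n} :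
    SameBlock P i j ↔ SameBlock P j i :=
  ⟨SameBlock.symm, SameBlock.symm⟩

theorem IsIntervalPartition.eq_of_mem {n : ℕ} {P : Finset (Finset (Fin n))}
    (hP : IsIntervalPartition P) {G H : Finset (Fin n)} {i : Fin n} (hG : G ∈ P) (hH : H ∈ P)
    (hiG : i ∈ G) (hiH : i ∈ H) : G = H :=
  (hP.2.1 i).unique ⟨hG, hiG⟩ ⟨hH, hiH⟩

theorem IsIntervalPartition.mem_of_sameBlock {n : ℕ} {P : Finset (Finset (Fin n))}
    (hP : IsIntervalPartition P) {G : Finset (Fin n)} {i j : Fin n} (hG : G ∈ P) (hi : i ∈ G)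
    (h : SameBlock P i j) : j ∈ G := by
  obtain ⟨H, hH, hiH, hjH⟩ := h
  rwa [hP.eq_of_mem hG hH hi hiH]

theorem IsIntervalPartition.sameBlock_trans {n : ℕ} {P : Finset (Finset (Fin n))}
    (hP : IsIntervalPartition P) {i j k : Fin n} (hij : SameBlock P i j)
    (hjk : SameBlock P j k) : SameBlock P i k :=
  let ⟨G, hG, hi, hj⟩ := hij
  ⟨G, hG, hi, hP.mem_of_sameBlock hG hj hjk⟩

theorem IsIntervalPartition.refines {n : ℕ} {P Q : Finset (Finset (Fin n))}
    (hP : IsIntervalPartition P) (hQ : IsIntervalPartition Q)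
    (h : ∀ i j, SameBlock P i j → SameBlock Q i j) : Refines P Q := by
  intro G hG
  obtain ⟨i, hi⟩ := hP.1 G hG
  obtain ⟨H, ⟨hH, hiH⟩, -⟩ := hQ.2.1 i
  exact ⟨H, hH, fun j hj => hQ.mem_of_sameBlock hH hiH (h i j ⟨G, hG, hi, hj⟩)⟩

theorem IsIntervalPartition.subset_of_sameBlock_iff {n : ℕ} {P Q : Finset (Finset (Fin n))}
    (hP : IsIntervalPartition P) (hQ : IsIntervalPartition Q)
    (h : ∀ i j, SameBlock P i j ↔ SameBlock Q i j) : P ⊆ Q := by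
  intro G hG
  obtain ⟨i, hi⟩ := hP.1 G hG
  obtain ⟨H, ⟨hH, hiH⟩, -⟩ := hQ.2.1 i
  suffices G = H by rwa [this]
  ext j
  exact ⟨fun hj => hQ.mem_of_sameBlock hH hiH ((h i j).1 ⟨G, hG, hi, hj⟩),
    fun hj => hP.mem_of_sameBlock hG hi ((h i j).2 ⟨H, hH, hiH, hj⟩)⟩

theorem IsIntervalPartition.eq_of_sameBlock_iff {n : ℕ} {P Q : Finset (Finset (Fin n))}
    (hP : IsIntervalPartition P) (hQ : IsIntervalPartition Q)
    (h : ∀ i j, SameBlock P i j ↔ SameBlock Q i j) : P = Q :=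
  (hP.subset_of_sameBlock_iff hQ h).antisymm
    (hQ.subset_of_sameBlock_iff hP fun i j => (h i j).symm)

theorem IsGroupPartition.sameBlock_iff_of_le {n : ℕ} {z : Fin n → ℝ}
    {P : Finset (Finset (Fin n))} (hP : IsGroupPartition z P) (hz : Antitone z) {i j : Fin n}
    (hij : i ≤ j) : SameBlock P i j ↔ z i = z j := by
  obtain ⟨a, ha⟩ := i
  obtain ⟨b, hb⟩ := j
  replace hij : a ≤ b := hij
  induction b, hij using Nat.le_induction with
  | base =>
    obtain ⟨G, hG, -⟩ := hP.1.2.1 ⟨a, ha⟩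
    exact iff_of_true ⟨G, hG.1, hG.2, hG.2⟩ rfl
  | succ b hab ih =>
    have hb' : b < n := by omega
    have hstep := hP.2 ⟨b, hb'⟩ hb
    have h₁ : z ⟨b, hb'⟩ ≤ z ⟨a, ha⟩ := hz (show (⟨a, ha⟩ : Fin n) ≤ ⟨b, hb'⟩ from hab)
    have h₂ : z ⟨b + 1, hb⟩ ≤ z ⟨b, hb'⟩ :=
      hz (show (⟨b, hb'⟩ : Fin n) ≤ ⟨b + 1, hb⟩ from Nat.le_succ b)
    constructor
    · rintro ⟨G, hG, haG, hbG⟩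
      have hbG' : (⟨b, hb'⟩ : Fin n) ∈ G :=
        hP.1.2.2 G hG _ haG _ hbG _ hab (Nat.le_succ b)
      have h₃ := (ih hb').1 ⟨G, hG, haG, hbG'⟩
      have h₄ := hstep.1 ⟨G, hG, hbG', hbG⟩
      dsimp only at h₄
      linarith
    · intro h
      exact hP.1.sameBlock_trans ((ih hb').2 (by linarith)) (hstep.2 (by dsimp only; linarith))

/-- For an antitone vector, the blocks of `𝒢(z)` are the level sets of `z`. -/
theorem IsGroupPartition.sameBlock_iff {n : ℕ} {z : Fin n → ℝ}
    {P : Finset (Finset (Fin n))} (hP : IsGroupPartition z P) (hz : Antitone z) (i j : Fin n) :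
    SameBlock P i j ↔ z i = z j := by
  rcases le_total i j with h | h
  · exact hP.sameBlock_iff_of_le hz h
  · rw [sameBlock_comm, hP.sameBlock_iff_of_le hz h, eq_comm]

theorem IsAvg.eq_of_sameBlock {n : ℕ} {P : Finset (Finset (Fin n))} {z v : Fin n → ℝ}
    (h : IsAvg P z v) {i j : Fin n} (hij : SameBlock P i j) : v i = v j :=
  let ⟨G, hG, hi, hj⟩ := hij
  (h G hG i hi).trans (h G hG j hj).symm

theorem antitone_sub_smul_of_le_rmin {n : ℕ} {z w : Fin n → ℝ} (hz : Antitone z)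
    (hw : Antitone w) {l : ℝ} (hl : (l : EReal) ≤ rmin z w) : Antitone (z - l • w) := by
  have hstep : ∀ (a : ℕ) (ha : a + 1 < n),
      (z - l • w) ⟨a + 1, ha⟩ ≤ (z - l • w) ⟨a, by omega⟩ := by
    intro a ha
    have hle : (⟨a, by omega⟩ : Fin n) ≤ ⟨a + 1, ha⟩ := Nat.le_succ a
    have hz' := hz hle
    have hw' := hw hle
    have hl' := hl.trans (iInf_le _ (⟨a, by omega⟩ : Fin n))
    simp only [ha, dite_true] at hl'
    simp only [Pi.sub_apply, Pi.smul_apply, smul_eq_mul]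
    split_ifs at hl' with h₀
    · rw [sub_eq_zero.1 h₀]
      linarith
    · have hpos : 0 < w ⟨a, by omega⟩ - w ⟨a + 1, ha⟩ :=
        (sub_nonneg.2 hw').lt_of_ne' h₀
      rw [EReal.coe_le_coe_iff, le_div_iff₀ hpos] at hl'
      linarith
  rintro ⟨a, ha⟩ ⟨b, hb⟩ hab
  replace hab : a ≤ b := hab
  induction b, hab using Nat.le_induction with
  | base => exact le_rfl
  | succ b hab ih => exact (hstep b hb).trans (ih _)

theorem nprime_spec {n : ℕ} {z w : Fin n → ℝ} {l : ℝ} {m : Fin n}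
    (hm : (m : ℕ) + 1 = nprime z w l) :
    z m - l * w m < 0 ∧ ∀ i < m, 0 ≤ z i - l * w i := by
  constructor
  · have hne : {k | k = n + 1 ∨ ∃ i : Fin n, i.val + 1 = k ∧ z i - l * w i < 0}.Nonempty :=
      ⟨n + 1, Or.inl rfl⟩
    rcases Nat.sInf_mem hne with h | ⟨i, hi, hneg⟩
    · have : (m : ℕ) + 1 = n + 1 := hm.trans h
      omega
    · have : i = m := Fin.ext (Nat.succ_injective (hi.trans hm.symm))
      rwa [← this]
  · intro i him
    by_contra! hneg
    have : nprime z w l ≤ (i : ℕ) + 1 := Nat.sInf_le (Or.inr ⟨i, rfl, hneg⟩)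
    omega

/-- Truncating at level `λ₀` leaves the weighted sum strictly above `ε`. -/
theorem lt_dot_posPart_lam0 {n : ℕ} (hn : 0 < n) {z w : Fin n → ℝ} {ε : ℝ} (hz : z ∈ coneT n)
    (hw : w ∈ coneT n) {m : Fin n} (hneg : z m - lam0 hn z w ε * w m < 0)
    (hm : z (lastIdx hn) < z m) :
    ε < dot w fun i => max ((z - lam0 hn z w ε • w) i) 0 := by
  set l := lam0 hn z w ε with hl
  set s := Finset.univ.filter fun i => z (lastIdx hn) < z i with hs
  have hms : m ∈ s := by simpa [hs] using hm
  have hwm : 0 < w m := by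
    refine (hw.2 m).lt_of_ne fun h => ?_
    rw [← h, mul_zero, sub_zero] at hneg
    exact hneg.not_ge (hz.2 m)
  have hden : 0 < ∑ i ∈ s, w i ^ 2 :=
    Finset.sum_pos' (fun i _ => sq_nonneg _) ⟨m, hms, by positivity⟩
  have hsum : ∑ i ∈ s, w i * (z i - l * w i) = ε := by
    have h : l * ∑ i ∈ s, w i ^ 2 = ∑ i ∈ s, z i * w i - ε := by
      rw [hl, lam0, div_mul_cancel₀ _ hden.ne']
    rw [Finset.mul_sum] at h
    calc ∑ i ∈ s, w i * (z i - l * w i) = ∑ i ∈ s, z i * w i - ∑ i ∈ s, l * w i ^ 2 := by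
          rw [← Finset.sum_sub_distrib]
          exact Finset.sum_congr rfl fun i _ => by ring
      _ = ε := by rw [h]; ring
  calc ε = ∑ i ∈ s, w i * (z i - l * w i) := hsum.symm
    _ < ∑ i ∈ s, w i * max ((z - l • w) i) 0 := by
        refine Finset.sum_lt_sum
          (fun i _ => mul_le_mul_of_nonneg_left (le_max_left _ _) (hw.2 i)) ⟨m, hms, ?_⟩
        exact mul_lt_mul_of_pos_left (hneg.trans_le (le_max_right _ _)) hwm
    _ ≤ _ := Finset.sum_le_univ_sum_of_nonneg fun i => mul_nonneg (hw.2 i) (le_max_right _ _)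

/-- Merging every block of `P` from the block of `m` on into the single block `{m, …}`. -/
def mergeTail {n : ℕ} (P : Finset (Finset (Fin n))) (m : Fin n) : Finset (Finset (Fin n)) :=
  P.filter (fun G => ∀ i ∈ G, i < m) ∪ {Finset.Ici m}

theorem sameBlock_mergeTail_iff {n : ℕ} {P : Finset (Finset (Fin n))} {m : Fin n}
    (hm : ∀ i j, SameBlock P i j → i < m → j < m) (i j : Fin n) :
    SameBlock (mergeTail P m) i j ↔ (i < m ∧ SameBlock P i j) ∨ (m ≤ i ∧ m ≤ j) := by
  constructor
  · rintro ⟨G, hG, hi, hj⟩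
    rcases Finset.mem_union.1 hG with h | h
    · rw [Finset.mem_filter] at h
      exact Or.inl ⟨h.2 i hi, G, h.1, hi, hj⟩
    · rw [Finset.mem_singleton] at h
      subst h
      exact Or.inr ⟨Finset.mem_Ici.1 hi, Finset.mem_Ici.1 hj⟩
  · rintro (⟨him, G, hG, hi, hj⟩ | ⟨hi, hj⟩)
    · exact ⟨G, Finset.mem_union_left _
        (Finset.mem_filter.2 ⟨hG, fun k hk => hm i k ⟨G, hG, hi, hk⟩ him⟩), hi, hj⟩
    · exact ⟨Finset.Ici m, Finset.mem_union_right _ (Finset.mem_singleton_self _),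
        Finset.mem_Ici.2 hi, Finset.mem_Ici.2 hj⟩

theorem IsIntervalPartition.mergeTail {n : ℕ} {P : Finset (Finset (Fin n))}
    (hP : IsIntervalPartition P) {m : Fin n} (hm : ∀ i j, SameBlock P i j → i < m → j < m) :
    IsIntervalPartition (mergeTail P m) := by
  refine ⟨fun G hG => ?_, fun i => ?_, fun G hG i hi k hk j hij hjk => ?_⟩
  · rcases Finset.mem_union.1 hG with h | h
    · exact hP.1 G (Finset.mem_filter.1 h).1
    · exact ⟨m, by simp [Finset.mem_singleton.1 h]⟩
  · rcases lt_or_ge i m with him | him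
    · obtain ⟨G, ⟨hG, hi⟩, huniq⟩ := hP.2.1 i
      refine ⟨G, ⟨Finset.mem_union_left _
        (Finset.mem_filter.2 ⟨hG, fun k hk => hm i k ⟨G, hG, hi, hk⟩ him⟩), hi⟩, ?_⟩
      rintro H ⟨hH, hiH⟩
      rcases Finset.mem_union.1 hH with h | h
      · exact huniq H ⟨(Finset.mem_filter.1 h).1, hiH⟩
      · rw [Finset.mem_singleton.1 h, Finset.mem_Ici] at hiH
        exact absurd him hiH.not_gt
    · refine ⟨Finset.Ici m, ⟨Finset.mem_union_right _ (Finset.mem_singleton_self _),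
        Finset.mem_Ici.2 him⟩, ?_⟩
      rintro H ⟨hH, hiH⟩
      rcases Finset.mem_union.1 hH with h | h
      · exact absurd ((Finset.mem_filter.1 h).2 i hiH) him.not_gt
      · exact Finset.mem_singleton.1 h
  · rcases Finset.mem_union.1 hG with h | h
    · exact hP.2.2 G (Finset.mem_filter.1 h).1 i hi k hk j hij hjk
    · rw [Finset.mem_singleton.1 h, Finset.mem_Ici] at hi ⊢
      exact hi.trans hij

theorem card_mergeTail_lt {n : ℕ} {P : Finset (Finset (Fin n))} (hP : IsIntervalPartition P)
    {m k : Fin n} (hmk : m ≤ k) (hsep : ¬ SameBlock P m k) :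
    (mergeTail P m).card < P.card := by
  obtain ⟨G, ⟨hG, hmG⟩, -⟩ := hP.2.1 m
  obtain ⟨H, ⟨hH, hkH⟩, -⟩ := hP.2.1 k
  have hGH : G ≠ H := by
    rintro rfl
    exact hsep ⟨G, hG, hmG, hkH⟩
  have htwo : 1 < (P.filter fun G => ¬ ∀ i ∈ G, i < m).card :=
    Finset.one_lt_card.2 ⟨G, Finset.mem_filter.2 ⟨hG, fun h => (h m hmG).false⟩,
      H, Finset.mem_filter.2 ⟨hH, fun h => (h k hkH).not_ge hmk⟩, hGH⟩
  have hsplit := Finset.card_filter_add_card_filter_not (s := P) fun G => ∀ i ∈ G, i < m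
  have hunion := Finset.card_union_le (P.filter fun G => ∀ i ∈ G, i < m) {Finset.Ici m}
  rw [Finset.card_singleton] at hunion
  rw [_root_.mergeTail]
  omega

/-- Alternative 6. If `λ₁ ≤ r < ∞`, `zₙ − λ₁wₙ < 0`, `λ₀ ≤ r`, and
`n' < n` with `z_{n'} ≠ zₙ`, then `𝒢₀ = {G ∈ 𝒢(z) : max G < n'} ∪ {{n', …, n}}`
satisfies `𝒢₀ ∈ 𝒫ₙ`, `𝒢(z) ≼ 𝒢₀ = 𝒢(z_{𝒢₀}) ≼ 𝒢*`, and `|𝒢(z_{𝒢₀})| ≤ |𝒢(z)| − 1`.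
The condition `n' < n` with `z_{n'} ≠ zₙ` is expressed by the witness `i : Fin n`
with `i + 1 = n'` (1-based indexing). -/
theorem alternative_six {n : ℕ} (hn : 0 < n) (ε : ℝ) (hε : 0 < ε)
    (w : Fin n → ℝ) (hw_anti : Antitone w) (hw_nonneg : ∀ i, 0 ≤ w i) (hw_ne : w ≠ 0)
    (z : Fin n → ℝ) (hz : z ∈ coneT n) (hw : w ∈ coneT n) (hzw : ε < dot w z)
    (Gz : Finset (Finset (Fin n))) (hGz : IsGroupPartition z Gz) (hwG : IsAvg Gz w w)
    (xs : Fin n → ℝ) (hxs : IsProjOn (hyperplane w ε ∩ coneT n) z xs)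
    (Gs : Finset (Finset (Fin n))) (hGs : IsGroupPartition xs Gs)
    (hr1 : (lam1 z w ε : EReal) ≤ rmin z w) (hr2 : rmin z w < ⊤)
    (hzn : z (lastIdx hn) - lam1 z w ε * w (lastIdx hn) < 0)
    (hl0r : (lam0 hn z w ε : EReal) ≤ rmin z w)
    (np : ℕ) (hnp_def : np = nprime z w (lam0 hn z w ε))
    (hnp : ∃ i : Fin n, (i : ℕ) + 1 = np ∧ (i : ℕ) + 1 < n ∧ z i ≠ z (lastIdx hn))
    (G0 : Finset (Finset (Fin n)))
    (hG0 : G0 = Gz.filter (fun G => ∀ i : Fin n, i ∈ G → (i : ℕ) + 1 < np) ∪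
      {Finset.univ.filter (fun i : Fin n => np ≤ (i : ℕ) + 1)})
    (za : Fin n → ℝ) (hza : IsAvg G0 z za)
    (Gza : Finset (Finset (Fin n))) (hGza : IsGroupPartition za Gza) :
    IsIntervalPartition G0 ∧ Refines Gz G0 ∧ G0 = Gza ∧ Refines G0 Gs ∧
      Gza.card ≤ Gz.card - 1 := by
  obtain ⟨m, hmnp, hmn, hzm⟩ := hnp
  have hlast : ∀ i : Fin n, i ≤ lastIdx hn := fun i => by
    simp only [Fin.le_def, lastIdx]
    omega
  have hzm' : z (lastIdx hn) < z m := (hz.1 (hlast m)).lt_of_ne' hzm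
  obtain ⟨hneg, hmin⟩ := nprime_spec (hmnp.trans hnp_def)
  have hblock : ∀ i j, SameBlock Gz i j ↔ z i = z j := hGz.sameBlock_iff hz.1
  have hwz : ∀ i j, z i = z j → w i = w j := fun i j h =>
    hwG.eq_of_sameBlock ((hblock i j).2 h)
  have hbefore : ∀ i, i < m → z m < z i := by
    intro i him
    refine (hz.1 him.le).lt_of_ne fun h => ?_
    have h₁ := hmin i him
    rw [← h, ← hwz _ _ h] at h₁
    exact h₁.not_gt hneg
  have hm : ∀ i j, SameBlock Gz i j → i < m → j < m := by
    intro i j hij him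
    by_contra! hmj
    have h₁ := hz.1 hmj
    rw [← (hblock i j).1 hij] at h₁
    exact h₁.not_gt (hbefore i him)
  obtain rfl : G0 = mergeTail Gz m := by
    rw [hG0, mergeTail, ← hmnp]
    congr 2
    · ext G
      simp only [Fin.lt_def, Nat.add_lt_add_iff_right]
    · ext i
      simp only [Finset.mem_filter, Finset.mem_univ, true_and, Finset.mem_Ici, Fin.le_def,
        Nat.add_le_add_iff_right]
  have hG0part := hGz.1.mergeTail hm
  have hG0block := sameBlock_mergeTail_iff hm
  have hxs_anti : Antitone xs := hxs.1.2.1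
  obtain ⟨l, hl⟩ := hxs.exists_isConeProj hε hw hw_ne
  have hanti := antitone_sub_smul_of_le_rmin hz.1 hw.1 hl0r
  have hlt : lam0 hn z w ε < l := by
    refine lt_of_isConeProj hl (isConeProj_posPart hanti) ?_
    rw [show dot w xs = ε from hxs.1.1]
    exact lt_dot_posPart_lam0 hn hz hw hneg hzm'
  have hxs_tail : ∀ k, m ≤ k → xs k = 0 := fun k hk => by
    refine hl.eq_zero_of_neg (fun j hj => ?_) hk
    have h₁ : (z - lam0 hn z w ε • w) j < 0 := (hanti hj).trans_lt hneg
    have h₂ := mul_le_mul_of_nonneg_right hlt.le (hw.2 j)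
    simp only [Pi.sub_apply, Pi.smul_apply, smul_eq_mul] at h₁ ⊢
    linarith
  have hxs_level : ∀ i j, SameBlock Gz i j → SameBlock Gs i j := by
    have hle : ∀ i j, i ≤ j → z i = z j → xs i = xs j := by
      intro i j hij hzij
      refine hl.eq_of_const hij fun k hik hkj => ?_
      have hzk : z k = z i := le_antisymm (hz.1 hik) (hzij.trans_le (hz.1 hkj))
      simp [hzk, hwz k i hzk]
    intro i j hij
    rw [hblock] at hij
    rw [hGs.sameBlock_iff hxs_anti]
    rcases le_total i j with h | h
    · exact hle i j h hij
    · exact (hle j i h hij.symm).symm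
  have hza_head : ∀ i, i < m → za i = z i := by
    intro i him
    obtain ⟨G, ⟨hG, hi⟩, -⟩ := hG0part.2.1 i
    have hconst : ∀ k ∈ G, z k = z i := fun k hk => by
      rcases (hG0block i k).1 ⟨G, hG, hi, hk⟩ with h | h
      · exact ((hblock i k).1 h.2).symm
      · exact absurd him h.1.not_gt
    have hcard : (G.card : ℝ) ≠ 0 := by
      exact_mod_cast (Finset.card_pos.2 ⟨i, hi⟩).ne'
    rw [hza G hG i hi, Finset.sum_congr rfl hconst, Finset.sum_const, nsmul_eq_mul,
      mul_div_cancel_left₀ _ hcard]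
  have hza_tail : ∀ i, m ≤ i → za i ≤ z m := by
    intro i hmi
    have hcard : (0 : ℝ) < ((Finset.Ici m).card : ℝ) := by
      exact_mod_cast Finset.card_pos.2 ⟨m, Finset.mem_Ici.2 le_rfl⟩
    rw [hza (Finset.Ici m) (Finset.mem_union_right _ (Finset.mem_singleton_self _)) i
      (Finset.mem_Ici.2 hmi), div_le_iff₀ hcard, mul_comm, ← nsmul_eq_mul]
    exact Finset.sum_le_card_nsmul _ _ _ fun k hk => hz.1 (Finset.mem_Ici.1 hk)
  have hza_const : ∀ i j, m ≤ i → m ≤ j → za i = za j := fun i j hi hj =>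
    hza.eq_of_sameBlock ((hG0block i j).2 (Or.inr ⟨hi, hj⟩))
  have hza_sep : ∀ i j, i < m → m ≤ j → za j < za i := fun i j hi hj => by
    rw [hza_head i hi]
    exact (hza_tail j hj).trans_lt (hbefore i hi)
  have hza_anti : Antitone za := by
    intro i j hij
    rcases lt_or_ge j m with hj | hj
    · rw [hza_head i (hij.trans_lt hj), hza_head j hj]
      exact hz.1 hij
    · rcases lt_or_ge i m with hi | hi
      · exact (hza_sep i j hi hj).le
      · exact (hza_const j i hj hi).le
  have hGza_eq : mergeTail Gz m = Gza := by
    refine hG0part.eq_of_sameBlock_iff hGza.1 fun i j => ?_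
    rw [hG0block, hGza.sameBlock_iff hza_anti, hblock]
    rcases lt_or_ge i m with hi | hi <;> rcases lt_or_ge j m with hj | hj
    · simp [hi, hi.not_ge, hza_head i hi, hza_head j hj]
    · simpa [hi, hi.not_ge, (hza_sep i j hi hj).ne'] using
        ((hz.1 hj).trans_lt (hbefore i hi)).ne'
    · simp [hi, hj.not_ge, hi.not_gt, (hza_sep j i hj hi).ne]
    · simp [hi, hj, hza_const i j hi hj]
  refine ⟨hG0part, hGz.1.refines hG0part fun i j hij => ?_, hGza_eq,
    hG0part.refines hGs.1 fun i j hij => ?_, ?_⟩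
  · rcases lt_or_ge i m with hi | hi
    · exact (hG0block i j).2 (Or.inl ⟨hi, hij⟩)
    · exact (hG0block i j).2 (Or.inr ⟨hi, not_lt.1 fun hj => hi.not_gt (hm j i hij.symm hj)⟩)
  · rcases (hG0block i j).1 hij with h | h
    · exact hxs_level i j h.2
    · rw [hGs.sameBlock_iff hxs_anti, hxs_tail i h.1, hxs_tail j h.2]
  · rw [← hGza_eq]
    exact Nat.le_sub_one_of_lt (card_mergeTail_lt hGz.1 (hlast m)
      (by rwa [hblock]))
end
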